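/- Let ω, ψ : ℝ³ → ℝ be ℤ³-periodic and twice continuously differentiable. Assume: (i) the ergodicity condition (E) holds for ω; (ii) the set {k ∈ ℝ³ : det(Hess ω(k)) = 0} has Lebesgue measure zero. If ψ is a collisional invariant, i.e. ψ(k₁) + ψ(k₂) = ψ(k₁ + k₂) for all k₁, k₂ ∈ ℝ³ with ω(k₁) + ω(k₂) = ω(k₁ + k₂), then there exists a constant a ∈ ℝ such that ψ(k) = a·ω(k) for all k. -/

import Mathlib

open MeasureTheory

/-- The Hessian matrix of second partial derivatives of `f` at `k`. -/
noncomputable def hess (f : (Fin 3 → ℝ) → ℝ) (k : Fin 3 → ℝ) : Matrix (Fin 3) (Fin 3) ℝ :=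
  Matrix.of fun i j => fderiv ℝ (fun x => fderiv ℝ f x (Pi.single j 1)) k (Pi.single i 1)

/-- `f` is `ℤ³`-periodic. -/
def PeriodicZ3 (f : (Fin 3 → ℝ) → ℝ) : Prop :=
  ∀ (k : Fin 3 → ℝ) (n : Fin 3 → ℤ), f (k + fun i => (n i : ℝ)) = f k

/-- `k` is a lattice point of `ℤ³`. -/
def IsLattice (k : Fin 3 → ℝ) : Prop := ∃ n : Fin 3 → ℤ, k = fun i => (n i : ℝ)

/-- `k` is linked by a collision to `q` (both off the lattice). -/
def LinkedByCollision (ω : (Fin 3 → ℝ) → ℝ) (k q : Fin 3 → ℝ) : Prop :=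
  ¬ IsLattice k ∧ ¬ IsLattice q ∧ ω k + ω q = ω (k + q)

/-- Ergodicity condition (E): every pair of non-lattice points is connected by
a finite chain of collisions. -/
def ErgodicityE (ω : (Fin 3 → ℝ) → ℝ) : Prop :=
  ∀ k k' : Fin 3 → ℝ, ¬ IsLattice k → ¬ IsLattice k' →
    Relation.ReflTransGen (LinkedByCollision ω) k k'

open Filter Topology Matrix

/-- gradient -/
noncomputable def grad3 (f : (Fin 3 → ℝ) → ℝ) (k : Fin 3 → ℝ) : Fin 3 → ℝ :=
  fun j => fderiv ℝ f k (Pi.single j 1)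

/-- gradient minus gradient at the origin -/
noncomputable def hh (f : (Fin 3 → ℝ) → ℝ) (k : Fin 3 → ℝ) : Fin 3 → ℝ :=
  grad3 f k - grad3 f 0

/-- collision defect -/
def FF (f : (Fin 3 → ℝ) → ℝ) (k x : Fin 3 → ℝ) : ℝ := f k + f x - f (k + x)

lemma fderiv_eq_dot (f : (Fin 3 → ℝ) → ℝ) (k v : Fin 3 → ℝ) :
    fderiv ℝ f k v = grad3 f k ⬝ᵥ v := by
  have : v = ∑ j, v j • (Pi.single j 1 : Fin 3 → ℝ) := by
    ext i; simp [Finset.sum_apply, Pi.single_apply]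
  conv_lhs => rw [this]
  simp [map_sum, dotProduct, grad3, mul_comm]

lemma grad_contDiff {f : (Fin 3 → ℝ) → ℝ} (hf : ContDiff ℝ 2 f) : ContDiff ℝ 1 (grad3 f) := by
  rw [contDiff_pi]
  intro j
  have := hf.fderiv_right (m := 1) (by norm_num)
  exact this.clm_apply contDiff_const

lemma hh_contDiff {f : (Fin 3 → ℝ) → ℝ} (hf : ContDiff ℝ 2 f) : ContDiff ℝ 1 (hh f) :=
  (grad_contDiff hf).sub contDiff_const

lemma hess_eq {f : (Fin 3 → ℝ) → ℝ} (hf : ContDiff ℝ 2 f) (k : Fin 3 → ℝ) (i j : Fin 3) :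
    hess f k i j = fderiv ℝ (hh f) k (Pi.single i 1) j := by
  have h1 : fderiv ℝ (hh f) k = fderiv ℝ (grad3 f) k := by
    unfold hh
    exact fderiv_sub_const _
  have hd : DifferentiableAt ℝ (grad3 f) k := (grad_contDiff hf).differentiable (by norm_num) k
  rw [h1]
  have h2 := fderiv_apply (𝕜 := ℝ) hd j
  show fderiv ℝ (fun x => grad3 f x j) k (Pi.single i 1) = _
  rw [h2]; rfl

lemma fderiv_hh {f : (Fin 3 → ℝ) → ℝ} (hf : ContDiff ℝ 2 f) (k v : Fin 3 → ℝ) :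
    fderiv ℝ (hh f) k v = v ᵥ* hess f k := by
  have : v = ∑ j, v j • (Pi.single j 1 : Fin 3 → ℝ) := by
    ext i; simp [Finset.sum_apply, Pi.single_apply]
  conv_lhs => rw [this]
  ext j
  simp only [map_sum, map_smul, Finset.sum_apply, Pi.smul_apply, smul_eq_mul, vecMul, dotProduct,
    hess_eq hf]

lemma det_continuous {f : (Fin 3 → ℝ) → ℝ} (hf : ContDiff ℝ 2 f) :
    Continuous fun k => (hess f k).det := by
  apply Continuous.matrix_det
  apply continuous_matrix
  intro i j
  simp only [hess_eq hf]
  have := (hh_contDiff hf).continuous_fderiv (by norm_num)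
  fun_prop

lemma map_nhds_hh {f : (Fin 3 → ℝ) → ℝ} (hf : ContDiff ℝ 2 f) {k : Fin 3 → ℝ}
    (hk : (hess f k).det ≠ 0) : map (hh f) (𝓝 k) = 𝓝 (hh f k) := by
  have hs : HasStrictFDerivAt (hh f) (fderiv ℝ (hh f) k) k :=
    (hh_contDiff hf).contDiffAt.hasStrictFDerivAt (by norm_num)
  apply hs.map_nhds_eq_of_surj
  rw [LinearMap.range_eq_top]
  intro w
  have : IsUnit (hess f k) := by
    rw [Matrix.isUnit_iff_isUnit_det]; exact isUnit_iff_ne_zero.mpr hk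
  obtain ⟨v, hv⟩ := Matrix.vecMul_surjective_iff_isUnit.mpr this w
  exact ⟨v, by simpa [fderiv_hh hf] using hv⟩

lemma ev_solve {f : (Fin 3 → ℝ) → ℝ} (hf : ContDiff ℝ 2 f) {k : Fin 3 → ℝ}
    (hk : (hess f k).det ≠ 0) (w : Fin 3 → ℝ) {U : Set (Fin 3 → ℝ)} (hU : U ∈ 𝓝 k) :
    ∀ᶠ s in 𝓝 (0:ℝ), ∃ y ∈ U, hh f y = hh f k + s • w := by
  have h1 : hh f '' U ∈ 𝓝 (hh f k) := by
    rw [← map_nhds_hh hf hk]; exact image_mem_map hU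
  have h2 : Tendsto (fun s : ℝ => hh f k + s • w) (𝓝 0) (𝓝 (hh f k)) := by
    have : Continuous (fun s : ℝ => hh f k + s • w) := by fun_prop
    simpa using this.tendsto 0
  exact h2 h1

lemma ev_pos {φ : ℝ → ℝ} {c : ℝ} (h0 : φ 0 = 0) (h : HasDerivAt φ c 0) (hc : 0 < c) :
    ∀ᶠ t in 𝓝[>] (0:ℝ), 0 < φ t := by
  have h1 := hasDerivAt_iff_tendsto_slope.mp h
  have h2 : ∀ᶠ t in 𝓝[≠] (0:ℝ), 0 < slope φ 0 t := h1.eventually (lt_mem_nhds hc)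
  have h3 : 𝓝[>] (0:ℝ) ≤ 𝓝[≠] (0:ℝ) := nhdsWithin_mono _ (fun x hx => ne_of_gt hx)
  filter_upwards [h3 h2, self_mem_nhdsWithin] with t ht ht0
  have ht0 : 0 < t := ht0
  simp only [slope_def_field, h0, sub_zero] at ht
  exact (div_pos_iff_of_pos_right ht0).mp ht

lemma FF_deriv {f : (Fin 3 → ℝ) → ℝ} (hf : ContDiff ℝ 2 f) (k d : Fin 3 → ℝ) :
    HasDerivAt (fun t : ℝ => FF f k (t • d)) (-(hh f k ⬝ᵥ d)) 0 := by
  have hD : Differentiable ℝ f := hf.differentiable (by norm_num)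
  have ht : HasDerivAt (fun t : ℝ => t • d) d 0 := by
    simpa using (hasDerivAt_id (0:ℝ)).smul_const d
  have h1 : HasDerivAt (fun t : ℝ => f (t • d)) (fderiv ℝ f 0 d) 0 := by
    have := (hD ((0:ℝ) • d)).hasFDerivAt.comp_hasDerivAt (0:ℝ) ht
    simpa [Function.comp_def] using this
  have h2 : HasDerivAt (fun t : ℝ => f (k + t • d)) (fderiv ℝ f k d) 0 := by
    have := (hD (k + (0:ℝ) • d)).hasFDerivAt.comp_hasDerivAt (0:ℝ) (ht.const_add k)
    simpa [Function.comp_def] using this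
  have h3 := (h1.const_add (f k)).sub h2
  refine h3.congr_deriv ?_
  rw [fderiv_eq_dot, fderiv_eq_dot, hh, sub_dotProduct]; ring

lemma FF_cont {f : (Fin 3 → ℝ) → ℝ} (hf : ContDiff ℝ 2 f) :
    Continuous fun p : (Fin 3 → ℝ) × (Fin 3 → ℝ) => FF f p.1 p.2 := by
  have := hf.continuous
  unfold FF; fun_prop

lemma ivt_step {f : (Fin 3 → ℝ) → ℝ} (hf : ContDiff ℝ 2 f) (f0 : f 0 = 0) {k : Fin 3 → ℝ}
    (hk : (hess f k).det ≠ 0) {d : Fin 3 → ℝ} (hd : d ≠ 0) (hkd : hh f k ⬝ᵥ d = 0)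
    {ε : ℝ} (hε : 0 < ε) :
    ∃ W : Set (Fin 3 → ℝ), IsOpen W ∧ (∀ᶠ t in 𝓝[>] (0:ℝ), t • d ∈ W) ∧
      ∀ x ∈ W, ∃ y ∈ Metric.ball k ε, FF f y x = 0 := by
  have e1 := ev_solve hf hk d (Metric.ball_mem_nhds k hε)
  have e2 := ev_solve hf hk (-d) (Metric.ball_mem_nhds k hε)
  obtain ⟨s, ⟨⟨y, hy, hy'⟩, ⟨z, hz, hz'⟩⟩, hs⟩ :=
    (((e1.and e2).filter_mono (nhdsWithin_le_nhds (s := Set.Ioi 0))).and self_mem_nhdsWithin).exists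
  have hs : 0 < s := hs
  have hdd : 0 < d ⬝ᵥ d := by
    have : d ⬝ᵥ d ≠ 0 := fun h => hd (dotProduct_self_eq_zero.mp h)
    have h2 : 0 ≤ d ⬝ᵥ d := Finset.sum_nonneg fun i _ => mul_self_nonneg _
    exact lt_of_le_of_ne h2 this.symm
  have cy : Continuous fun x => FF f y x := (FF_cont hf).comp (by fun_prop : Continuous fun x => (y, x))
  have cz : Continuous fun x => FF f z x := (FF_cont hf).comp (by fun_prop : Continuous fun x => (z, x))
  refine ⟨{x | FF f y x < 0} ∩ {x | 0 < FF f z x}, (isOpen_lt cy continuous_const).inter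
    (isOpen_lt continuous_const cz), ?_, ?_⟩
  · have a1 : ∀ᶠ t in 𝓝[>] (0:ℝ), 0 < -FF f y (t • d) := by
      apply ev_pos _ (FF_deriv hf y d).neg
      · rw [hy', add_dotProduct, hkd, smul_dotProduct]
        simp; positivity
      · simp [FF, f0]
    have a2 : ∀ᶠ t in 𝓝[>] (0:ℝ), 0 < FF f z (t • d) := by
      apply ev_pos _ (FF_deriv hf z d)
      · rw [hz', add_dotProduct, hkd, smul_dotProduct]
        simp; positivity
      · simp [FF, f0]
    filter_upwards [a1, a2] with t h1 h2
    exact ⟨by simpa using h1, h2⟩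
  · rintro x ⟨h1, h2⟩
    have cx : Continuous fun w => FF f w x :=
      (FF_cont hf).comp (by fun_prop : Continuous fun w => (w, x))
    have := (convex_ball k ε).isPreconnected.intermediate_value hy hz cx.continuousOn
    obtain ⟨w, hw, hw'⟩ := this ⟨le_of_lt h1, le_of_lt h2⟩
    exact ⟨w, hw, hw'⟩

lemma multipliers {ω ψ : (Fin 3 → ℝ) → ℝ} (hω : ContDiff ℝ 2 ω) (hψ : ContDiff ℝ 2 ψ)
    (hinv : ∀ k₁ k₂ : Fin 3 → ℝ, ω k₁ + ω k₂ = ω (k₁ + k₂) → ψ k₁ + ψ k₂ = ψ (k₁ + k₂))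
    {y x : Fin 3 → ℝ} (h : FF ω y x = 0) :
    ∃ a b : ℝ, (a, b) ≠ 0 ∧ a • (hh ω y - hh ω x) + b • (hh ψ y - hh ψ x) = 0 := by
  have key : ∀ f : (Fin 3 → ℝ) → ℝ, ContDiff ℝ 2 f →
      HasStrictFDerivAt (fun e => f (y + e) + f (x - e)) (fderiv ℝ f y - fderiv ℝ f x) 0 := by
    intro f hf
    have s1 : ∀ p, HasStrictFDerivAt f (fderiv ℝ f p) p :=
      fun p => hf.contDiffAt.hasStrictFDerivAt (by norm_num)
    have h1 : HasStrictFDerivAt (fun e => f (y + e)) (fderiv ℝ f y) 0 := by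
      have := (s1 (y + 0)).comp (0 : Fin 3 → ℝ) ((hasStrictFDerivAt_id (𝕜 := ℝ) (0 : Fin 3 → ℝ)).const_add y)
      simpa [Function.comp_def] using this
    have h2 : HasStrictFDerivAt (fun e => f (x - e)) (-fderiv ℝ f x) 0 := by
      have := (s1 (x - 0)).comp (0 : Fin 3 → ℝ) ((hasStrictFDerivAt_id (𝕜 := ℝ) (0 : Fin 3 → ℝ)).const_sub x)
      simpa [Function.comp_def] using this
    have h3 := h1.add h2
    rw [← sub_eq_add_neg] at h3
    exact h3
  have hext : IsLocalExtrOn (fun e => ψ (y + e) + ψ (x - e))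
      {e | ω (y + e) + ω (x - e) = ω (y + 0) + ω (x - 0)} 0 := by
    left
    have h0 : ω y + ω x = ω (y + x) := by unfold FF at h; linarith
    filter_upwards [self_mem_nhdsWithin] with e he
    have he : ω (y + e) + ω (x - e) = ω (y + 0) + ω (x - 0) := he
    have e1 : y + e + (x - e) = y + x := by abel
    have a1 := hinv (y + e) (x - e) (by rw [he, e1]; simpa using h0)
    have a2 := hinv y x h0
    rw [e1] at a1
    simp only [add_zero, sub_zero]
    linarith
  obtain ⟨a, b, hab, heq⟩ := hext.exists_multipliers_of_hasStrictFDerivAt_1d (key ω hω) (key ψ hψ)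
  refine ⟨a, b, hab, ?_⟩
  ext j
  have := congrArg (fun L => L (Pi.single j 1)) heq
  simpa [hh, grad3] using this

lemma parallel {ω ψ : (Fin 3 → ℝ) → ℝ} (hω : ContDiff ℝ 2 ω) (hψ : ContDiff ℝ 2 ψ)
    (hinv : ∀ k₁ k₂ : Fin 3 → ℝ, ω k₁ + ω k₂ = ω (k₁ + k₂) → ψ k₁ + ψ k₂ = ψ (k₁ + k₂))
    (ω0 : ω 0 = 0) {k : Fin 3 → ℝ} (hk : hh ω k ≠ 0) :
    hh ψ k = ((hh ψ k ⬝ᵥ hh ω k) / (hh ω k ⬝ᵥ hh ω k)) • hh ω k := by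
  obtain ⟨a, b, hab, h⟩ := multipliers hω hψ hinv (y := k) (x := 0) (by simp [FF, ω0])
  have z1 : hh ω 0 = 0 := by simp [hh]
  have z2 : hh ψ 0 = 0 := by simp [hh]
  rw [z1, z2, sub_zero, sub_zero] at h
  have hb : b ≠ 0 := by
    rintro rfl
    have : a ≠ 0 := by rintro rfl; exact hab rfl
    simp [this, hk] at h
  have hg : hh ψ k = (-(a / b)) • hh ω k := by
    have : b • hh ψ k = -(a • hh ω k) := by rw [eq_neg_iff_add_eq_zero, add_comm]; exact h
    calc hh ψ k = b⁻¹ • b • hh ψ k := by rw [smul_smul, inv_mul_cancel₀ hb, one_smul]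
      _ = _ := by rw [this, smul_neg, smul_smul, neg_smul]; congr 2; field_simp
  have hdd : hh ω k ⬝ᵥ hh ω k ≠ 0 := fun h => hk (dotProduct_self_eq_zero.mp h)
  rw [hg, smul_dotProduct, smul_eq_mul, mul_div_cancel_right₀ _ hdd]

/-- the multiplier -/
noncomputable def lam (ω ψ : (Fin 3 → ℝ) → ℝ) (k : Fin 3 → ℝ) : ℝ :=
  (hh ψ k ⬝ᵥ hh ω k) / (hh ω k ⬝ᵥ hh ω k)

lemma lam_eq {ω ψ : (Fin 3 → ℝ) → ℝ} (hω : ContDiff ℝ 2 ω) (hψ : ContDiff ℝ 2 ψ)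
    (hinv : ∀ k₁ k₂ : Fin 3 → ℝ, ω k₁ + ω k₂ = ω (k₁ + k₂) → ψ k₁ + ψ k₂ = ψ (k₁ + k₂))
    (ω0 : ω 0 = 0) {y x : Fin 3 → ℝ} (h : FF ω y x = 0) (hc : crossProduct (hh ω y) (hh ω x) ≠ 0) :
    lam ω ψ y = lam ω ψ x := by
  have hy : hh ω y ≠ 0 := by intro h; simp [h] at hc
  have hx : hh ω x ≠ 0 := by intro h; simp [h] at hc
  obtain ⟨a, b, hab, h⟩ := multipliers hω hψ hinv h
  have py : hh ψ y = lam ω ψ y • hh ω y := parallel hω hψ hinv ω0 hy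
  have px : hh ψ x = lam ω ψ x • hh ω x := parallel hω hψ hinv ω0 hx
  rw [py, px] at h
  have hl := (crossProduct_ne_zero_iff_linearIndependent.mp hc)
  rw [LinearIndependent.pair_iff] at hl
  have := hl (a + b * lam ω ψ y) (-(a + b * lam ω ψ x)) (by rw [← h]; module)
  obtain ⟨h1, h2⟩ := this
  have hb : b ≠ 0 := by
    rintro rfl
    apply hab
    have : a = 0 := by simpa using h1
    simp [this]
  apply mul_left_cancel₀ hb
  linarith

lemma lam_cont {ω ψ : (Fin 3 → ℝ) → ℝ} (hω : ContDiff ℝ 2 ω) (hψ : ContDiff ℝ 2 ψ)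
    {k : Fin 3 → ℝ} (hk : hh ω k ≠ 0) : ContinuousAt (lam ω ψ) k := by
  have c1 := (hh_contDiff hω).continuous
  have c2 := (hh_contDiff hψ).continuous
  have hdd : hh ω k ⬝ᵥ hh ω k ≠ 0 := fun h => hk (dotProduct_self_eq_zero.mp h)
  exact (c2.dotProduct c1).continuousAt.div (c1.dotProduct c1).continuousAt hdd

lemma cross_cont {f : (Fin 3 → ℝ) → ℝ} (hf : ContDiff ℝ 2 f) :
    Continuous fun p : (Fin 3 → ℝ) × (Fin 3 → ℝ) => crossProduct (hh f p.1) (hh f p.2) := by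
  have c1 := (hh_contDiff hf).continuous
  simp only [cross_apply]
  apply continuous_pi
  intro i
  fin_cases i <;> simp <;> fun_prop

lemma local_step {ω ψ : (Fin 3 → ℝ) → ℝ} (hω : ContDiff ℝ 2 ω) (hψ : ContDiff ℝ 2 ψ)
    (hinv : ∀ k₁ k₂ : Fin 3 → ℝ, ω k₁ + ω k₂ = ω (k₁ + k₂) → ψ k₁ + ψ k₂ = ψ (k₁ + k₂))
    (ω0 : ω 0 = 0) {k : Fin 3 → ℝ} (hk : hh ω k ≠ 0) (hN : (hess ω k).det ≠ 0)
    {d : Fin 3 → ℝ} (hd : d ≠ 0) (hkd : hh ω k ⬝ᵥ d = 0) {ε : ℝ} (hε : 0 < ε) :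
    ∃ W : Set (Fin 3 → ℝ), IsOpen W ∧ (∀ᶠ t in 𝓝[>] (0:ℝ), t • d ∈ W) ∧
      ∀ x ∈ W, hh ω x ≠ 0 → |lam ω ψ x - lam ω ψ k| < ε := by
  -- the neighbourhood where `lam` is close
  have hdd : hh ω k ⬝ᵥ hh ω k ≠ 0 := fun h => hk (dotProduct_self_eq_zero.mp h)
  have hU : ∀ᶠ y in 𝓝 k, |lam ω ψ y - lam ω ψ k| < ε := by
    have := (Metric.continuousAt_iff'.mp (lam_cont hω hψ hk)) ε hε
    simpa [Real.dist_eq] using this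
  have hU2 := hU.eventually_nhds
  have hU3 : ∀ᶠ y in 𝓝 k, (hess ω y).det ≠ 0 :=
    (det_continuous hω).continuousAt.eventually_ne hN
  obtain ⟨s, ⟨k', ⟨hk'1, hk'2⟩, hk'3⟩, hs⟩ :=
    (((ev_solve hω hN (crossProduct d (hh ω k)) (hU2.and hU3)).filter_mono
      (nhdsWithin_le_nhds (s := Set.Ioi 0))).and self_mem_nhdsWithin).exists
  have hs : 0 < s := hs
  have hcr : crossProduct (hh ω k) (hh ω k') ≠ 0 := by
    have : crossProduct (hh ω k) (hh ω k') = (s * (hh ω k ⬝ᵥ hh ω k)) • d := by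
      rw [hk'3, map_add, cross_self, zero_add, map_smul, mul_smul]
      congr 1
      simp only [dotProduct, Fin.sum_univ_three] at hkd
      simp only [cross_apply, dotProduct, Fin.sum_univ_three]
      ext i
      fin_cases i <;> simp
      · linear_combination (-(hh ω k 0)) * hkd
      · linear_combination (-(hh ω k 1)) * hkd
      · linear_combination (-(hh ω k 2)) * hkd
    rw [this]
    exact smul_ne_zero (mul_ne_zero hs.ne' hdd) hd
  have hk'd : hh ω k' ⬝ᵥ d = 0 := by
    rw [hk'3, add_dotProduct, hkd, smul_dotProduct, dotProduct_comm, dot_self_cross]; simp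
  have hcn : ∀ᶠ p in 𝓝 (k, k'), crossProduct (hh ω p.1) (hh ω p.2) ≠ 0 :=
    (cross_cont hω).continuousAt.eventually_ne hcr
  rw [nhds_prod_eq] at hcn
  obtain ⟨pa, ha, pb, hb, hab⟩ := eventually_prod_iff.mp hcn
  obtain ⟨r1, hr1, hB1⟩ := Metric.eventually_nhds_iff_ball.mp (ha.and hU)
  obtain ⟨r2, hr2, hB2⟩ := Metric.eventually_nhds_iff_ball.mp (hb.and hk'1)
  obtain ⟨W1, o1, t1, w1⟩ := ivt_step hω ω0 hN hd hkd hr1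
  obtain ⟨W2, o2, t2, w2⟩ := ivt_step hω ω0 hk'2 hd hk'd hr2
  refine ⟨W1 ∩ W2, o1.inter o2, t1.and t2, ?_⟩
  rintro x ⟨hx1, hx2⟩ hx
  obtain ⟨y1, hy1, f1⟩ := w1 x hx1
  obtain ⟨y2, hy2, f2⟩ := w2 x hx2
  obtain ⟨a1, l1⟩ := hB1 y1 hy1
  obtain ⟨a2, l2⟩ := hB2 y2 hy2
  have hcc := hab a1 a2
  by_cases c1 : crossProduct (hh ω y1) (hh ω x) = 0
  · by_cases c2 : crossProduct (hh ω y2) (hh ω x) = 0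
    · exfalso
      -- both parallel to `hh ω x`
      have par : ∀ u : Fin 3 → ℝ, crossProduct u (hh ω x) = 0 → ∃ c : ℝ, u = c • hh ω x := by
        intro u hu
        by_contra hcon
        push Not at hcon
        apply (crossProduct_ne_zero_iff_linearIndependent.mpr ?_) (hu : crossProduct u (hh ω x) = 0)
        rw [LinearIndependent.pair_iff]
        intro p q hpq
        by_cases hp : p = 0
        · subst hp; simpa [hx] using hpq
        · exfalso
          apply hcon (-(q / p))
          have : p • u = -(q • hh ω x) := by rw [eq_neg_iff_add_eq_zero]; exact hpq
          calc u = p⁻¹ • p • u := by rw [smul_smul, inv_mul_cancel₀ hp, one_smul]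
            _ = _ := by rw [this, smul_neg, smul_smul, neg_smul]; congr 2; field_simp
      obtain ⟨c, hc⟩ := par _ c1
      obtain ⟨c', hc'⟩ := par _ c2
      apply hcc
      simp [hc, hc', cross_self]
    · rw [← lam_eq hω hψ hinv ω0 f2 c2]; exact l2
  · rw [← lam_eq hω hψ hinv ω0 f1 c1]; exact l1

lemma omega_zero {ω : (Fin 3 → ℝ) → ℝ} (hωper : PeriodicZ3 ω) (hω : Continuous ω)
    (hE : ErgodicityE ω) : ω 0 = 0 := by
  have hex : ∀ n : ℕ, ∃ q : Fin 3 → ℝ, q ∈ Set.Icc (0 : Fin 3 → ℝ) 1 ∧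
      ω (fun _ => 1 / ((n:ℝ) + 2)) + ω q = ω ((fun _ => 1 / ((n:ℝ) + 2)) + q) := by
    intro n
    have nl : ∀ m : ℕ, ¬ IsLattice (fun _ => 1 / ((m:ℝ) + 2)) := by
      rintro m ⟨z, hz⟩
      have h : 1 / ((m:ℝ) + 2) = (z 0 : ℝ) := congrFun hz 0
      have h1 : (0:ℝ) < z 0 := by rw [← h]; positivity
      have h2 : (z 0 : ℝ) < 1 := by
        rw [← h, div_lt_one (by positivity)]
        have : (0:ℝ) ≤ m := Nat.cast_nonneg m
        linarith
      have h1 : 0 < z 0 := by exact_mod_cast h1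
      have h2 : z 0 < 1 := by exact_mod_cast h2
      omega
    rcases (hE _ _ (nl n) (nl (n+1))).cases_head with h | ⟨q, ⟨_, _, hq⟩, _⟩
    · exfalso
      have h : 1 / ((n:ℝ) + 2) = 1 / (((n + 1 : ℕ) : ℝ) + 2) := congrFun h 0
      have : (0:ℝ) ≤ n := Nat.cast_nonneg n
      field_simp at h
      push_cast at h
      linarith
    · refine ⟨fun i => Int.fract (q i), ⟨fun i => Int.fract_nonneg _, fun i => (Int.fract_lt_one _).le⟩, ?_⟩
      have e : (fun i => Int.fract (q i)) = q + fun i => ((-⌊q i⌋ : ℤ) : ℝ) := by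
        ext i; simp [Int.fract, sub_eq_add_neg]
      rw [e, ← add_assoc, hωper, hωper, hq]
  choose q hq hq' using hex
  obtain ⟨a, _, φ, hφ, hlim⟩ := (isCompact_Icc (a := (0 : Fin 3 → ℝ)) (b := 1)).tendsto_subseq hq
  have hk : Tendsto (fun n : ℕ => (fun _ => 1 / ((φ n : ℝ) + 2) : Fin 3 → ℝ)) atTop (𝓝 0) := by
    rw [tendsto_pi_nhds]
    intro i
    have h1 : Tendsto (fun n : ℕ => (φ n : ℝ) + 2) atTop atTop :=
      tendsto_atTop_add_const_right _ _ (tendsto_natCast_atTop_atTop.comp hφ.tendsto_atTop)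
    have h2 := h1.inv_tendsto_atTop
    simp only [one_div]
    exact h2
  have l1 : Tendsto (fun n => ω (fun _ => 1 / ((φ n : ℝ) + 2)) + ω (q (φ n))) atTop (𝓝 (ω 0 + ω a)) :=
    ((hω.tendsto 0).comp hk).add ((hω.tendsto a).comp hlim)
  have l2 : Tendsto (fun n => ω ((fun _ => 1 / ((φ n : ℝ) + 2)) + q (φ n))) atTop (𝓝 (ω (0 + a))) :=
    (hω.tendsto (0 + a)).comp (hk.add hlim)
  have : (fun n => ω (fun _ => 1 / ((φ n : ℝ) + 2)) + ω (q (φ n))) =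
      (fun n => ω ((fun _ => 1 / ((φ n : ℝ) + 2)) + q (φ n))) := funext fun n => hq' (φ n)
  rw [this] at l1
  have := tendsto_nhds_unique l1 l2
  simp at this
  exact this

lemma dense_N {ω : (Fin 3 → ℝ) → ℝ}
    (hhess : volume {k : Fin 3 → ℝ | (hess ω k).det = 0} = 0) :
    Dense {k : Fin 3 → ℝ | (hess ω k).det ≠ 0} := by
  apply Measure.dense_of_ae (μ := volume)
  rw [ae_iff]; simpa using hhess

lemma dense_NM {ω : (Fin 3 → ℝ) → ℝ} (hω : ContDiff ℝ 2 ω)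
    (hhess : volume {k : Fin 3 → ℝ | (hess ω k).det = 0} = 0) :
    Dense {k : Fin 3 → ℝ | (hess ω k).det ≠ 0 ∧ hh ω k ≠ 0} := by
  rw [dense_iff_inter_open]
  intro U hU hne
  obtain ⟨k, hkU, hk⟩ := (dense_N hhess).inter_open_nonempty U hU hne
  have h3 : ∀ᶠ y in 𝓝 k, (hess ω y).det ≠ 0 :=
    (det_continuous hω).continuousAt.eventually_ne hk
  have e1 := ev_solve hω hk 1 ((hU.eventually_mem hkU).and h3)
  have e2 := ev_solve hω hk (-1) ((hU.eventually_mem hkU).and h3)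
  obtain ⟨s, ⟨⟨y, ⟨hyU, hyN⟩, hy⟩, ⟨z, ⟨hzU, hzN⟩, hz⟩⟩, hs⟩ :=
    (((e1.and e2).filter_mono (nhdsWithin_le_nhds (s := Set.Ioi 0))).and self_mem_nhdsWithin).exists
  have hs : 0 < s := hs
  by_cases h : hh ω y = 0
  · refine ⟨z, hzU, hzN, ?_⟩
    intro h'
    rw [hy] at h; rw [hz] at h'
    have a := congrFun h 0
    have b := congrFun h' 0
    simp at a b
    linarith
  · exact ⟨y, hyU, hyN, h⟩

theorem collisional_invariant_is_multiple_of_omega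
    (ω ψ : (Fin 3 → ℝ) → ℝ)
    (hωper : PeriodicZ3 ω) (hψper : PeriodicZ3 ψ)
    (hωC2 : ContDiff ℝ 2 ω) (hψC2 : ContDiff ℝ 2 ψ)
    (hE : ErgodicityE ω)
    (hhess : volume {k : Fin 3 → ℝ | (hess ω k).det = 0} = 0)
    (hinv : ∀ k₁ k₂ : Fin 3 → ℝ, ω k₁ + ω k₂ = ω (k₁ + k₂) → ψ k₁ + ψ k₂ = ψ (k₁ + k₂)) :
    ∃ a : ℝ, ∀ k, ψ k = a * ω k := by
  have ω0 := omega_zero hωper hωC2.continuous hE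
  have ψ0 : ψ 0 = 0 := by
    have := hinv 0 0 (by simp [ω0])
    simpa using this
  have hD := dense_NM hωC2 hhess
  have hconst : ∀ k k', ((hess ω k).det ≠ 0 ∧ hh ω k ≠ 0) → ((hess ω k').det ≠ 0 ∧ hh ω k' ≠ 0) →
      lam ω ψ k = lam ω ψ k' := by
    rintro k k' ⟨hN, hM⟩ ⟨hN', hM'⟩
    obtain ⟨d, hd, hdv⟩ := (Matrix.exists_mulVec_eq_zero_iff
      (M := Matrix.of ![hh ω k, hh ω k', 0])).mpr (by simp [Matrix.det_fin_three])
    have d1 : hh ω k ⬝ᵥ d = 0 := by simpa [mulVec] using congrFun hdv 0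
    have d2 : hh ω k' ⬝ᵥ d = 0 := by simpa [mulVec] using congrFun hdv 1
    by_contra hne
    have hε : 0 < |lam ω ψ k - lam ω ψ k'| / 2 := by
      have := abs_pos.mpr (sub_ne_zero.mpr hne)
      positivity
    obtain ⟨W, oW, tW, hW⟩ := local_step hωC2 hψC2 hinv ω0 hM hN hd d1 hε
    obtain ⟨W', oW', tW', hW'⟩ := local_step hωC2 hψC2 hinv ω0 hM' hN' hd d2 hε
    obtain ⟨t, ht⟩ := (tW.and tW').exists
    obtain ⟨x, ⟨hx1, hx2⟩, _, hx⟩ := hD.inter_open_nonempty (W ∩ W') (oW.inter oW') ⟨t • d, ht⟩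
    have b1 := hW x hx1 hx
    have b2 := hW' x hx2 hx
    have b3 := abs_sub_le (lam ω ψ k) (lam ω ψ x) (lam ω ψ k')
    rw [abs_sub_comm (lam ω ψ k) (lam ω ψ x)] at b3
    linarith
  obtain ⟨k₀, hk₀⟩ := hD.nonempty
  refine ⟨lam ω ψ k₀, ?_⟩
  set a := lam ω ψ k₀ with ha
  have hall : hh ψ = fun k => a • hh ω k := by
    apply Continuous.ext_on hD (hh_contDiff hψC2).continuous
      ((hh_contDiff hωC2).continuous.const_smul a)
    intro k hk
    show hh ψ k = a • hh ω k
    rw [ha, hconst k₀ k hk₀ hk]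
    exact parallel hωC2 hψC2 hinv ω0 hk.2
  have dω : Differentiable ℝ ω := hωC2.differentiable (by norm_num)
  have dψ : Differentiable ℝ ψ := hψC2.differentiable (by norm_num)
  let c : Fin 3 → ℝ := grad3 ψ 0 - a • grad3 ω 0
  let L : (Fin 3 → ℝ) →L[ℝ] ℝ := fderiv ℝ ψ 0 - a • fderiv ℝ ω 0
  have hz : ∀ x, fderiv ℝ (fun k => ψ k - a * ω k - L k) x = 0 := by
    intro x
    have h1 : HasFDerivAt (fun k => ψ k - a * ω k - L k)
        (fderiv ℝ ψ x - a • fderiv ℝ ω x - L) x :=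
      ((dψ x).hasFDerivAt.sub ((dω x).hasFDerivAt.const_mul a)).sub L.hasFDerivAt
    rw [h1.fderiv]
    ext1 v
    have h2 := congrFun hall x
    simp only [hh] at h2
    have h3 := congrArg (fun u => u ⬝ᵥ v) h2
    simp only [sub_dotProduct, smul_dotProduct, ← fderiv_eq_dot, smul_eq_mul] at h3
    simp [L]
    linarith
  have hcst : ∀ x, ψ x - a * ω x = L x := by
    intro x
    have := is_const_of_fderiv_eq_zero (𝕜 := ℝ)
      ((dψ.sub (dω.const_mul a)).sub L.differentiable) hz x 0
    simp [ω0, ψ0] at this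
    linarith
  have hL : ∀ i : Fin 3, L (Pi.single i 1) = 0 := by
    intro i
    have e : (Pi.single i 1 : Fin 3 → ℝ) = 0 + fun j => (((Pi.single i 1 : Fin 3 → ℤ) j : ℤ) : ℝ) := by
      ext j; simp [Pi.single_apply]
    rw [← hcst, e, hωper, hψper, ω0, ψ0]; simp
  intro k
  have hLk : L k = 0 := by
    have : k = ∑ j, k j • (Pi.single j 1 : Fin 3 → ℝ) := by
      ext i; simp [Finset.sum_apply, Pi.single_apply]
    rw [this, map_sum]
    simp only [map_smul, hL, smul_zero, Finset.sum_const_zero]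
  have := hcst k
  linarith
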